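/- Let p, q be integers with p ≡ 1 (mod 2) and q ≡ 1 (mod 2), and let n ≥ 1. Then the generalized Fibonacci–Lucas quaternion G^{p,q}_n is a zero divisor in H[Z_2] (equivalently, not a unit) if and only if n ≡ 2 (mod 3). -/

import Mathlib

open Quaternion

/-- The Lucas sequence, as integers: `l_n = 2·f_{n+1} - f_n`
(equivalently `l_0 = 2`, `l_1 = 1`, `l_{n+2} = l_{n+1} + l_n`). -/
def lucas (n : ℕ) : ℤ := 2 * (Nat.fib (n + 1) : ℤ) - (Nat.fib n : ℤ)

/-- The generalized Fibonacci–Lucas numbers `g^{p,q}_n = p·f_{n-1} + q·l_n` (for `n ≥ 1`). -/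
def genFL (p q : ℤ) (n : ℕ) : ℤ := p * (Nat.fib (n - 1) : ℤ) + q * lucas n

/-- The n-th generalized Fibonacci–Lucas quaternion over a commutative ring `R`:
`G^{p,q}_n = g^{p,q}_n + g^{p,q}_{n+1}·i + g^{p,q}_{n+2}·j + g^{p,q}_{n+3}·k` in `ℍ[R]`. -/
def genFLQuat (R : Type*) [CommRing R] (p q : ℤ) (n : ℕ) : ℍ[R] :=
  ⟨(genFL p q n : R), (genFL p q (n + 1) : R), (genFL p q (n + 2) : R), (genFL p q (n + 3) : R)⟩

theorem Quaternion.isUnit_iff_isUnit_normSq {R : Type*} [CommRing R] (a : ℍ[R]) :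
    IsUnit a ↔ IsUnit (Quaternion.normSq a) := by
  refine ⟨fun h => h.map Quaternion.normSq, fun h => ?_⟩
  have hu : IsUnit ((Quaternion.normSq a : R) : ℍ[R]) := h.map (algebraMap R ℍ[R])
  have hc : Commute a (star a) := by
    rw [Commute, SemiconjBy, Quaternion.self_mul_star, Quaternion.star_mul_self]
  rw [← Quaternion.self_mul_star, hc.isUnit_mul_iff] at hu
  exact hu.1

theorem genFL_succ_cast_zmod_two {p q : ℤ} (hp : p % 2 = 1) (hq : q % 2 = 1) (m : ℕ) :
    (genFL p q (m + 1) : ZMod 2) = Nat.fib (m + 2) := by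
  have cast_eq_one {a : ℤ} (ha : a % 2 = 1) : (a : ZMod 2) = 1 :=
    ZMod.intCast_eq_one_iff_odd.2 (Int.odd_iff.2 ha)
  simp only [genFL, lucas, Nat.add_sub_cancel, Int.cast_add, Int.cast_mul, Int.cast_sub,
    Int.cast_natCast, Int.cast_ofNat, cast_eq_one hp, cast_eq_one hq,
    Nat.fib_add_two (n := m), Nat.cast_add]
  linear_combination (Nat.fib m : ZMod 2) * CharTwo.two_eq_zero (R := ZMod 2)

theorem Nat.fib_cast_zmod_two_eq_zero_iff (m : ℕ) : (Nat.fib m : ZMod 2) = 0 ↔ m % 3 = 0 := by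
  rw [ZMod.natCast_eq_zero_iff, ← Nat.dvd_iff_mod_eq_zero, ← Nat.gcd_eq_left_iff_dvd,
    ← Nat.gcd_eq_left_iff_dvd, ← show Nat.fib 3 = 2 from rfl, ← Nat.fib_gcd]
  have : Nat.gcd 3 m = 1 ∨ Nat.gcd 3 m = 3 :=
    (Nat.dvd_prime Nat.prime_three).1 (Nat.gcd_dvd_left 3 m)
  rcases this with h | h <;> simp [h, Nat.fib_add_two]

theorem genFLQuat_zmod_two_odd_odd (p q : ℤ) (hp : p % 2 = 1) (hq : q % 2 = 1)
    (n : ℕ) (hn : 1 ≤ n) :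
    ¬ IsUnit (genFLQuat (ZMod 2) p q n) ↔ n % 3 = 2 := by
  obtain ⟨m, rfl⟩ := Nat.exists_eq_add_of_le' hn
  have normSq_eq : Quaternion.normSq (genFLQuat (ZMod 2) p q (m + 1)) = Nat.fib (m + 2) := by
    rw [Quaternion.normSq_def']
    simp only [genFLQuat, genFL_succ_cast_zmod_two hp hq, Nat.add_right_comm m 1,
      Nat.fib_add_two, Nat.cast_add]
    generalize (Nat.fib m : ZMod 2) = a, (Nat.fib (m + 1) : ZMod 2) = b
    revert a b
    decide
  rw [Quaternion.isUnit_iff_isUnit_normSq, normSq_eq, isUnit_iff_ne_zero, not_not,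
    Nat.fib_cast_zmod_two_eq_zero_iff]
  omega
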